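/- Let D be the open unit disk in ℝ² and D̄ its closure. Let f : ℝ² → ℝ² be continuously differentiable on an open set containing D̄, suppose det(Df(x)) > 0 for every x ∈ D, and suppose the restriction of f to the unit circle ∂D = {x ∈ ℝ² : ‖x‖ = 1} is injective. Then f is injective on D̄ (and hence is a bijection from D̄ onto f(D̄)). -/

import Mathlib

open Metric Set Filter Topology

/-- `F` has a continuous logarithm on `s`. -/
def HasContinuousLogOn (F : ℂ → ℂ) (s : Set ℂ) : Prop :=
  ∃ g : ℂ → ℂ, ContinuousOn g s ∧ ∀ z ∈ s, F z = Complex.exp (g z)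

namespace HasContinuousLogOn

variable {F G : ℂ → ℂ} {s t : Set ℂ}

theorem mono (h : HasContinuousLogOn F t) (hst : s ⊆ t) : HasContinuousLogOn F s :=
  let ⟨g, hg, hFg⟩ := h
  ⟨g, hg.mono hst, fun z hz => hFg z (hst hz)⟩

theorem congr (h : HasContinuousLogOn F s) (hFG : EqOn G F s) : HasContinuousLogOn G s :=
  let ⟨g, hg, hFg⟩ := h
  ⟨g, hg, fun z hz => (hFG hz).trans (hFg z hz)⟩

theorem mul (hF : HasContinuousLogOn F s) (hG : HasContinuousLogOn G s) :
    HasContinuousLogOn (fun z => F z * G z) s := by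
  obtain ⟨f, hf, hFf⟩ := hF
  obtain ⟨g, hg, hGg⟩ := hG
  exact ⟨fun z => f z + g z, hf.add hg, fun z hz => by
    simp only [hFf z hz, hGg z hz, Complex.exp_add]⟩

theorem prod {ι : Type*} {T : Finset ι} {F : ι → ℂ → ℂ}
    (h : ∀ i ∈ T, HasContinuousLogOn (F i) s) :
    HasContinuousLogOn (fun z => ∏ i ∈ T, F i z) s := by
  choose! g hg hFg using h
  refine ⟨fun z => ∑ i ∈ T, g i z, continuousOn_finsetSum _ hg, fun z hz => ?_⟩
  rw [Complex.exp_sum]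
  exact Finset.prod_congr rfl fun i hi => hFg i hi z hz

theorem of_mem_slitPlane (hF : ContinuousOn F s) (h : ∀ z ∈ s, F z ∈ Complex.slitPlane) :
    HasContinuousLogOn F s :=
  ⟨fun z => Complex.log (F z), hF.clog h,
    fun z hz => (Complex.exp_log (Complex.slitPlane_ne_zero (h z hz))).symm⟩

theorem const {c : ℂ} (hc : c ≠ 0) : HasContinuousLogOn (fun _ => c) s :=
  ⟨fun _ => Complex.log c, continuousOn_const, fun _ _ => (Complex.exp_log hc).symm⟩

/-- A function within relative distance less than one of a function with a logarithm has a
logarithm. -/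
theorem of_norm_sub_lt (hG : HasContinuousLogOn G s) (hF : ContinuousOn F s)
    (h : ∀ z ∈ s, ‖F z - G z‖ < ‖G z‖) : HasContinuousLogOn F s := by
  have hne : ∀ z ∈ s, G z ≠ 0 := fun z hz h0 => by
    have := h z hz
    rw [h0, norm_zero] at this
    exact (norm_nonneg _).not_gt this
  have hGc : ContinuousOn G s := by
    obtain ⟨g, hg, hGg⟩ := hG
    exact (Complex.continuous_exp.comp_continuousOn hg).congr hGg
  refine (hG.mul (G := fun z => F z / G z) (of_mem_slitPlane (hF.div hGc hne) ?_)).congr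
    fun z hz => (mul_div_cancel₀ _ (hne z hz)).symm
  intro z hz
  have h1 : ‖F z / G z - 1‖ < 1 := by
    rw [div_sub_one (hne z hz), norm_div, div_lt_one (norm_pos_iff.2 (hne z hz))]
    exact h z hz
  rw [← add_sub_cancel (1 : ℂ) (F z / G z)]
  exact Complex.mem_slitPlane_of_norm_lt_one h1

/-- A continuous nowhere vanishing function on a closed disk has a continuous logarithm. -/
theorem of_closedBall (hF : ContinuousOn F (closedBall 0 1))
    (h0 : ∀ z ∈ closedBall (0 : ℂ) 1, F z ≠ 0) : HasContinuousLogOn F (closedBall 0 1) := by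
  set r : ℂ → ℂ := fun z => ((max 1 ‖z‖ : ℝ) : ℂ)⁻¹ * z with hr
  have hpos : ∀ z : ℂ, 0 < max 1 ‖z‖ := fun z => lt_max_of_lt_left one_pos
  have hrc : Continuous r := by
    refine Continuous.mul (Continuous.inv₀ ?_ fun z => ?_) continuous_id
    · exact Complex.continuous_ofReal.comp (continuous_const.max continuous_norm)
    · exact_mod_cast (hpos z).ne'
  have hrm : ∀ z, r z ∈ closedBall (0 : ℂ) 1 := fun z => by
    rw [mem_closedBall_zero_iff, hr, norm_mul, norm_inv, Complex.norm_real,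
      Real.norm_of_nonneg (hpos z).le, inv_mul_le_one₀ (hpos z)]
    exact le_max_right _ _
  obtain ⟨g, ⟨-, hg⟩, -⟩ := Complex.isCoveringMapOn_exp.existsUnique_continuousMap_lifts
    ⟨F ∘ r, hF.comp_continuous hrc hrm⟩ (Complex.exp_log (h0 _ (hrm 0))) fun z => h0 _ (hrm z)
  refine ⟨g, g.continuous.continuousOn, fun z hz => ?_⟩
  have hrz : r z = z := by
    simp [hr, max_eq_left (mem_closedBall_zero_iff.1 hz)]
  simpa [hrz] using (congrFun hg z).symm

end HasContinuousLogOn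

/-- The identity has no continuous logarithm on the unit circle. -/
theorem not_hasContinuousLogOn_id : ¬ HasContinuousLogOn (fun z => z) (sphere (0 : ℂ) 1) := by
  rintro ⟨g, hg, h⟩
  set e : ℝ → ℂ := fun θ => Complex.exp (θ * Complex.I)
  have hem : ∀ θ, e θ ∈ sphere (0 : ℂ) 1 := fun θ => by simp [e, Complex.norm_exp_ofReal_mul_I]
  have hec : Continuous e := by fun_prop
  have hc : Continuous fun θ : ℝ => (g (e θ) - θ * Complex.I) / (2 * Real.pi * Complex.I) :=
    ((hg.comp_continuous hec hem).sub (by fun_prop)).div_const _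
  have hint : ∀ θ : ℝ, ∃ n : ℤ,
      (g (e θ) - θ * Complex.I) / (2 * Real.pi * Complex.I) = n := fun θ => by
    obtain ⟨n, hn⟩ := Complex.exp_eq_exp_iff_exists_int.1 (h _ (hem θ)).symm
    exact ⟨n, by rw [hn, add_sub_cancel_left, mul_div_cancel_right₀ _ Complex.two_pi_I_ne_zero]⟩
  choose n hn using hint
  have hnc : Continuous n := by
    rw [Int.isClosedEmbedding_coe_real.isEmbedding.continuous_iff]
    refine (Complex.continuous_re.comp hc).congr fun θ => ?_
    simp [hn θ]
  have h1 := hn 0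
  have h2 := hn (2 * Real.pi)
  have he : e (2 * Real.pi) = e 0 := by simp [e]
  rw [PreconnectedSpace.constant inferInstance hnc (x := 2 * Real.pi) (y := 0), ← h1, he,
    div_left_inj' Complex.two_pi_I_ne_zero] at h2
  simp [Real.pi_ne_zero] at h2

/-- Continuous logarithms of `F - p` exist for all `p` in a connected set missing the values
of `F`, as soon as one exists. -/
theorem HasContinuousLogOn.sub_const_of_isPreconnected {F : ℂ → ℂ} {s P : Set ℂ}
    (hs : IsCompact s) (hF : ContinuousOn F s) (hP : IsPreconnected P)
    (hPF : ∀ p ∈ P, ∀ z ∈ s, F z ≠ p) {p q : ℂ} (hp : p ∈ P) (hq : q ∈ P)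
    (h : HasContinuousLogOn (fun z => F z - p) s) :
    HasContinuousLogOn (fun z => F z - q) s := by
  have hcl : IsClosed (F '' s) := (hs.image_of_continuousOn hF).isClosed
  have key : ∀ a ∉ F '' s, ∃ ε > 0, ∀ b ∈ ball a ε, b ∉ F '' s ∧
      (HasContinuousLogOn (fun z => F z - a) s ↔ HasContinuousLogOn (fun z => F z - b) s) := by
    intro a ha
    obtain ⟨ε, hε, hball⟩ := Metric.isOpen_iff.1 hcl.isOpen_compl a ha
    have hfar : ∀ z ∈ s, ε ≤ ‖F z - a‖ := fun z hz => by
      by_contra! hlt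
      exact hball (mem_ball_iff_norm.2 hlt) (mem_image_of_mem F hz)
    refine ⟨ε / 2, half_pos hε, fun b hb => ⟨hball (ball_subset_ball (half_le_self hε.le) hb), ?_⟩⟩
    rw [mem_ball_iff_norm] at hb
    constructor <;> intro hlog <;> refine hlog.of_norm_sub_lt (by fun_prop) fun z hz => ?_
    · rw [sub_sub_sub_cancel_left, norm_sub_rev]
      linarith [hfar z hz]
    · rw [sub_sub_sub_cancel_left]
      have := norm_sub_le_norm_sub_add_norm_sub (F z) b a
      linarith [hfar z hz]
  have hopen : ∀ φ : Prop → Prop, IsOpen {a | a ∉ F '' s ∧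
      φ (HasContinuousLogOn (fun z => F z - a) s)} := by
    intro φ
    refine Metric.isOpen_iff.2 fun a ha => ?_
    obtain ⟨ε, hε, hb⟩ := key a ha.1
    exact ⟨ε, hε, fun b hbε => ⟨(hb b hbε).1, propext (hb b hbε).2 ▸ ha.2⟩⟩
  have hmem : ∀ a ∈ P, a ∉ F '' s := fun a ha ⟨z, hz, hza⟩ => hPF a ha z hz hza
  refine (hP.subset_left_of_subset_union (hopen id) (hopen Not) ?_ ?_ ⟨p, hp, hmem p hp, h⟩ hq).2
  · exact disjoint_left.2 fun a ha ha' => ha'.2 ha.2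
  · intro a ha
    by_cases hl : HasContinuousLogOn (fun z => F z - a) s
    exacts [Or.inl ⟨hmem a ha, hl⟩, Or.inr ⟨hmem a ha, hl⟩]

/-- If the image of the circle under `h` is disjoint from its rotation by `ρ`, then `h` has a
continuous logarithm. -/
theorem HasContinuousLogOn.of_disjoint_rotation {h : ℂ → ℂ} {ρ : ℂ} (hρ : ‖ρ‖ = 1)
    (hc : ContinuousOn h (sphere 0 1)) (h0 : ∀ z ∈ sphere (0 : ℂ) 1, h z ≠ 0)
    (hdisj : ∀ z ∈ sphere (0 : ℂ) 1, ∀ w ∈ sphere (0 : ℂ) 1, ρ * h z ≠ h w) :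
    HasContinuousLogOn h (sphere 0 1) := by
  have hS : IsCompact (sphere (0 : ℂ) 1) := isCompact_sphere _ _
  have hne : (sphere (0 : ℂ) 1).Nonempty := ⟨1, by simp⟩
  have hρ0 : ρ ≠ 0 := norm_ne_zero_iff.1 (hρ ▸ one_ne_zero)
  obtain ⟨a, ha, hmin⟩ := hS.exists_isMinOn hne hc.norm
  obtain ⟨b, hb, hmax⟩ := hS.exists_isMaxOn hne hc.norm
  have hnorm : ∀ z, ‖ρ * h z‖ = ‖h z‖ := fun z => by rw [norm_mul, hρ, one_mul]
  have hb0 : 0 < ‖h b‖ := norm_pos_iff.2 (h0 b hb)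
  set inner : Set ℂ := (fun t : ℝ => (t : ℂ) * h a) '' Icc 0 1
  set outer : Set ℂ := (fun t : ℝ => (t : ℂ) * h b) '' Ici 1
  have hcurve : IsPreconnected (h '' sphere (0 : ℂ) 1) :=
    (isPreconnected_sphere (by simp [Complex.rank_real_complex]) 0 1).image _ hc
  have hinner : IsPreconnected inner := isPreconnected_Icc.image _ (by fun_prop)
  have houter : IsPreconnected outer := isPreconnected_Ici.image _ (by fun_prop)
  have hP : IsPreconnected (inner ∪ h '' sphere (0 : ℂ) 1 ∪ outer) := by
    refine IsPreconnected.union (h b) (Or.inr ⟨b, hb, rfl⟩) ⟨1, by simp, by simp⟩ ?_ houter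
    exact IsPreconnected.union (h a) ⟨1, by simp, by simp⟩ ⟨a, ha, rfl⟩ hinner hcurve
  have hPF : ∀ p ∈ inner ∪ h '' sphere (0 : ℂ) 1 ∪ outer, ∀ z ∈ sphere (0 : ℂ) 1,
      ρ * h z ≠ p := by
    rintro p ((⟨t, ht, rfl⟩ | ⟨w, hw, rfl⟩) | ⟨t, ht, rfl⟩) z hz heq
    · have hn := congrArg norm heq
      rw [hnorm, norm_mul, Complex.norm_real, Real.norm_of_nonneg ht.1] at hn
      have hza : ‖h a‖ ≤ ‖h z‖ := hmin hz
      have ht1 : t = 1 := by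
        have := norm_pos_iff.2 (h0 a ha)
        exact le_antisymm ht.2 (by by_contra! hlt; nlinarith)
      exact hdisj z hz a ha (by simpa [ht1] using heq)
    · exact hdisj z hz w hw heq
    · have ht' : (1 : ℝ) ≤ t := ht
      have hn := congrArg norm heq
      rw [hnorm, norm_mul, Complex.norm_real, Real.norm_of_nonneg (by linarith)] at hn
      have hzb : ‖h z‖ ≤ ‖h b‖ := hmax hz
      have ht1 : t = 1 := le_antisymm (by by_contra! hlt; nlinarith) ht'
      exact hdisj z hz b hb (by simpa [ht1] using heq)
  have hfar : HasContinuousLogOn (fun z => ρ * h z - (2 : ℝ) * h b) (sphere 0 1) := by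
    refine (HasContinuousLogOn.const (c := -((2 : ℝ) * h b)) ?_).of_norm_sub_lt
      (by fun_prop) fun z hz => ?_
    · simpa using h0 b hb
    · have hzb : ‖h z‖ ≤ ‖h b‖ := hmax hz
      rw [sub_neg_eq_add, sub_add_cancel, hnorm, norm_neg, norm_mul, Complex.norm_real]
      norm_num
      linarith
  have hlog := hfar.sub_const_of_isPreconnected hS (by fun_prop) hP hPF
    (Or.inr ⟨2, by simp, rfl⟩) (q := 0) (Or.inl (Or.inl ⟨0, by simp, by simp⟩))
  refine ((HasContinuousLogOn.const (inv_ne_zero hρ0)).mul hlog).congr fun z _ => ?_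
  simp [hρ0]

/-- An injective function on the unit circle cannot wind more than once around the origin. -/
theorem le_one_of_injOn_of_eq_pow_mul {u Q : ℂ → ℂ} {n : ℕ}
    (hu : InjOn u (sphere 0 1)) (hQ : HasContinuousLogOn Q (sphere 0 1))
    (h : ∀ z ∈ sphere (0 : ℂ) 1, u z = z ^ n * Q z) : n ≤ 1 := by
  by_contra! hn
  obtain ⟨g, hg, hQg⟩ := hQ
  have hn0 : (n : ℂ) ≠ 0 := by exact_mod_cast (by omega : n ≠ 0)
  have hz0 : ∀ z ∈ sphere (0 : ℂ) 1, z ≠ 0 := fun z hz => ne_of_mem_sphere hz one_ne_zero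
  set r : ℂ → ℂ := fun z => z * Complex.exp (g z / n) with hr
  have hrc : ContinuousOn r (sphere 0 1) :=
    continuousOn_id.mul (Complex.continuous_exp.comp_continuousOn (hg.div_const _))
  have hr0 : ∀ z ∈ sphere (0 : ℂ) 1, r z ≠ 0 := fun z hz =>
    mul_ne_zero (hz0 z hz) (Complex.exp_ne_zero _)
  have hru : ∀ z ∈ sphere (0 : ℂ) 1, r z ^ n = u z := fun z hz => by
    rw [h z hz, hQg z hz, hr, mul_pow, ← Complex.exp_nat_mul, mul_div_cancel₀ _ hn0]
  set ρ : ℂ := Complex.exp (2 * Real.pi * Complex.I / n)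
  have hρ : IsPrimitiveRoot ρ n := Complex.isPrimitiveRoot_exp n (by omega)
  have hlog : HasContinuousLogOn r (sphere 0 1) := by
    refine HasContinuousLogOn.of_disjoint_rotation (hρ.norm'_eq_one (by omega)) hrc hr0
      fun z hz w hw heq => ?_
    have hzw : z = w := hu hz hw <| by
      rw [← hru z hz, ← hru w hw, ← heq, mul_pow ρ, hρ.pow_eq_one, one_mul]
    subst hzw
    exact hρ.ne_one hn (mul_right_cancel₀ (hr0 z hz) (heq.trans (one_mul _).symm))
  refine not_hasContinuousLogOn_id ((hlog.mul
    (G := fun z => Complex.exp (-(g z / n))) ⟨_, (hg.div_const _).neg, fun _ _ => rfl⟩).congr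
    fun z _ => ?_)
  simp [hr, mul_assoc, ← Complex.exp_add]

/-- Isolated zeros or singularities at which a function stays away from zero in direction can be
removed without changing the function on the boundary circle. -/
theorem exists_continuousOn_eqOn_sphere (S : Finset ℂ) : ∀ Q : ℂ → ℂ,
    (∀ x ∈ S, x ∈ ball (0 : ℂ) 1) → ContinuousOn Q (closedBall 0 1 \ S) →
    (∀ z ∈ closedBall (0 : ℂ) 1 \ S, Q z ≠ 0) →
    (∀ x ∈ S, ∃ c, ∀ᶠ z in 𝓝[≠] x, ‖Q z - c‖ < ‖c‖) →
    ∃ R : ℂ → ℂ, ContinuousOn R (closedBall 0 1) ∧ (∀ z ∈ closedBall (0 : ℂ) 1, R z ≠ 0) ∧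
      EqOn R Q (sphere 0 1) := by
  induction S using Finset.induction_on with
  | empty => exact fun Q _ hQ h0 _ => ⟨Q, by simpa using hQ, by simpa using h0, eqOn_refl _ _⟩
  | insert x S hxS ih =>
    intro Q hS hQ h0 hc
    obtain ⟨c, hcx⟩ := hc x (Finset.mem_insert_self _ _)
    have hnhds : ball (0 : ℂ) 1 ∩ (S : Set ℂ)ᶜ ∈ 𝓝 x :=
      (isOpen_ball.inter S.finite_toSet.isClosed.isOpen_compl).mem_nhds
        ⟨hS x (Finset.mem_insert_self _ _), hxS⟩
    obtain ⟨δ, hδ, hball⟩ := Metric.nhds_basis_closedBall.mem_iff.1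
      (inter_mem hnhds (eventually_nhdsWithin_iff.1 hcx))
    have hclose : ∀ z ∈ closedBall x δ, z ≠ x → ‖Q z - c‖ < ‖c‖ := fun z hz hzx =>
      (hball hz).2 hzx
    have hcne : c ≠ 0 := by
      obtain ⟨z, hz⟩ := hcx.exists
      exact norm_pos_iff.1 ((norm_nonneg _).trans_lt hz)
    set ψ : ℂ → ℝ := fun z => min 1 (‖z - x‖ / δ) with hψ
    have hψc : Continuous ψ := by fun_prop
    have hψ0 : ∀ z, 0 ≤ ψ z := fun z => le_min zero_le_one (by positivity)
    have hψ1 : ∀ z, ψ z ≤ 1 := fun z => min_le_left _ _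
    have hψx : ψ x = 0 := by simp [hψ]
    set Q₁ : ℂ → ℂ := fun z => c + ψ z * (Q z - c) with hQ₁
    have hout : ∀ z, z ∉ ball x δ → Q₁ z = Q z := fun z hz => by
      have h1 : ψ z = 1 := min_eq_left <| (one_le_div hδ).2 <| by
        simpa [dist_eq_norm] using hz
      simp [hQ₁, h1]
    have hcontx : ContinuousAt Q₁ x := by
      have : Tendsto (fun z => (ψ z : ℂ) * (Q z - c)) (𝓝 x) (𝓝 0) := by
        refine squeeze_zero_norm' (a := fun z => ψ z * ‖c‖) ?_ ?_
        · filter_upwards [closedBall_mem_nhds x hδ] with z hz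
          rw [norm_mul, Complex.norm_real, Real.norm_of_nonneg (hψ0 z)]
          by_cases hzx : z = x
          · simp [hzx, hψx]
          · exact mul_le_mul_of_nonneg_left (hclose z hz hzx).le (hψ0 z)
        · have := (hψc.tendsto x).mul_const ‖c‖
          rwa [hψx, zero_mul] at this
      simpa [ContinuousAt, hQ₁, hψx] using this.const_add c
    have hcont : ContinuousOn Q₁ (closedBall 0 1 \ S) := by
      intro z hz
      by_cases hzx : z = x
      · exact hzx ▸ hcontx.continuousWithinAt
      · have hzQ : ContinuousWithinAt Q (closedBall 0 1 \ S) z := by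
          refine (hQ z (by simpa [hzx] using hz)).mono_of_mem_nhdsWithin ?_
          filter_upwards [self_mem_nhdsWithin,
            mem_nhdsWithin_of_mem_nhds (isOpen_ne.mem_nhds hzx)] with w hw hwx
          simpa [hwx] using hw
        exact continuousWithinAt_const.add
          ((Complex.continuous_ofReal.comp hψc).continuousWithinAt.mul
            (hzQ.sub continuousWithinAt_const))
    have hne : ∀ z ∈ closedBall (0 : ℂ) 1 \ S, Q₁ z ≠ 0 := by
      intro z hz h
      by_cases hzx : z = x
      · exact hcne (by simpa [hQ₁, hzx, hψx] using h)
      by_cases hzb : z ∈ ball x δ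
      · have hlt : ‖(ψ z : ℂ) * (Q z - c)‖ < ‖c‖ := by
          rw [norm_mul, Complex.norm_real, Real.norm_of_nonneg (hψ0 z)]
          exact (mul_le_of_le_one_left (norm_nonneg _) (hψ1 z)).trans_lt
            (hclose z (ball_subset_closedBall hzb) hzx)
        rw [← norm_neg c, ← eq_neg_of_add_eq_zero_right h] at hlt
        exact hlt.false
      · exact h0 z (by simpa [hzx] using hz) ((hout z hzb).symm.trans h)
    have hdir : ∀ y ∈ S, ∃ d, ∀ᶠ z in 𝓝[≠] y, ‖Q₁ z - d‖ < ‖d‖ := by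
      intro y hy
      obtain ⟨d, hd⟩ := hc y (Finset.mem_insert_of_mem hy)
      refine ⟨d, ?_⟩
      have hyx : y ∉ closedBall x δ := fun h => (hball h).1.2 hy
      filter_upwards [hd, mem_nhdsWithin_of_mem_nhds
        (isClosed_closedBall.isOpen_compl.mem_nhds hyx)] with z hz hzx
      rwa [hout z fun h => hzx (ball_subset_closedBall h)]
    obtain ⟨R, hR, hR0, hRQ⟩ :=
      ih Q₁ (fun y hy => hS y (Finset.mem_insert_of_mem hy)) hcont hne hdir
    refine ⟨R, hR, hR0, fun z hz => (hRQ hz).trans (hout z fun hzb => ?_)⟩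
    exact sphere_disjoint_ball.notMem_of_mem_left hz (hball (ball_subset_closedBall hzb)).1.1

/-- A real-linear map of the plane with positive determinant is closer to some complex-linear map
than its norm. -/
theorem exists_norm_sub_mul_le_of_det_pos (A : ℂ →L[ℝ] ℂ) (hA : 0 < A.det) :
    ∃ a : ℂ, ∃ k < ‖a‖, ∀ z, ‖A z - a * z‖ ≤ k * ‖z‖ := by
  set a : ℂ := (A 1 - Complex.I * A Complex.I) / 2 with ha
  set b : ℂ := (A 1 + Complex.I * A Complex.I) / 2 with hb
  have hAz : ∀ z : ℂ, A z = z.re * A 1 + z.im * A Complex.I := fun z => by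
    have : z = z.re • (1 : ℂ) + z.im • Complex.I := by simp
    conv_lhs => rw [this, map_add, map_smul, map_smul]
    simp
  have hdet : A.det = (A 1).re * (A Complex.I).im - (A Complex.I).re * (A 1).im := by
    rw [ContinuousLinearMap.det, ← LinearMap.det_toMatrix Complex.basisOneI, Matrix.det_fin_two]
    simp [LinearMap.toMatrix_apply]
  refine ⟨a, ‖b‖, ?_, fun z => le_of_eq ?_⟩
  · rw [← sq_lt_sq₀ (norm_nonneg _) (norm_nonneg _), Complex.sq_norm, Complex.sq_norm,
      Complex.normSq_apply, Complex.normSq_apply]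
    rw [hdet] at hA
    simp [ha, hb]
    nlinarith
  · rw [← Complex.norm_conj z, ← norm_mul, hAz z]
    congr 1
    apply Complex.ext <;> simp [ha, hb] <;> ring

/-- Near a zero with positive Jacobian, `u z / (z - x)` stays close to a nonzero constant. -/
theorem exists_eventually_norm_div_sub_le {u : ℂ → ℂ} {x : ℂ} {A : ℂ →L[ℝ] ℂ}
    (hu : HasFDerivAt u A x) (hux : u x = 0) (hA : 0 < A.det) :
    ∃ a : ℂ, ∃ k < ‖a‖, ∀ᶠ z in 𝓝[≠] x, ‖u z / (z - x) - a‖ ≤ k := by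
  obtain ⟨a, k, hk, hAa⟩ := exists_norm_sub_mul_le_of_det_pos A hA
  obtain ⟨k', hkk', hk'⟩ := exists_between hk
  refine ⟨a, k', hk', ?_⟩
  filter_upwards [mem_nhdsWithin_of_mem_nhds (hu.isLittleO.def (sub_pos.2 hkk')),
    self_mem_nhdsWithin] with z hz hzx
  have hzx' : z - x ≠ 0 := sub_ne_zero.2 hzx
  rw [hux, sub_zero] at hz
  rw [div_sub' hzx', norm_div, div_le_iff₀ (norm_pos_iff.2 hzx'), mul_comm (z - x) a]
  have := norm_sub_le_norm_sub_add_norm_sub (u z) (A (z - x)) (a * (z - x))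
  linarith [hAa (z - x)]

/-- A continuous function on the closed disk with positive Jacobian in the interior which is
injective on the boundary circle takes no value off the image of the circle twice. -/
theorem eq_of_notMem_image_sphere {f : ℂ → ℂ} (hf : ContinuousOn f (closedBall 0 1))
    (hd : ∀ x ∈ ball (0 : ℂ) 1, ∃ A : ℂ →L[ℝ] ℂ, HasFDerivAt f A x ∧ 0 < A.det)
    (hinj : InjOn f (sphere 0 1)) {y : ℂ} (hy : y ∉ f '' sphere 0 1)
    {x₁ x₂ : ℂ} (hx₁ : x₁ ∈ ball (0 : ℂ) 1) (hx₂ : x₂ ∈ ball (0 : ℂ) 1)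
    (h₁ : f x₁ = y) (h₂ : f x₂ = y) : x₁ = x₂ := by
  set u : ℂ → ℂ := fun z => f z - y with hu
  have huc : ContinuousOn u (closedBall 0 1) := hf.sub continuousOn_const
  set Z : Set ℂ := closedBall 0 1 ∩ u ⁻¹' {0} with hZ
  have hZb : ∀ x ∈ Z, x ∈ ball (0 : ℂ) 1 := fun x hx => by
    refine mem_ball.2 (lt_of_le_of_ne (mem_closedBall.1 hx.1) fun h => ?_)
    exact hy ⟨x, h, sub_eq_zero.1 hx.2⟩
  have hloc : ∀ x ∈ Z, ∃ a : ℂ, ∃ k < ‖a‖, ∀ᶠ z in 𝓝[≠] x, ‖u z / (z - x) - a‖ ≤ k :=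
    fun x hx => by
      obtain ⟨A, hA, hdet⟩ := hd x (hZb x hx)
      exact exists_eventually_norm_div_sub_le (hA.sub_const y) hx.2 hdet
  have hfin : Z.Finite := by
    by_contra hinf
    have hZc : IsCompact Z :=
      (isCompact_closedBall _ _).of_isClosed_subset
        (huc.preimage_isClosed_of_isClosed isClosed_closedBall isClosed_singleton)
        inter_subset_left
    obtain ⟨x, hx, hacc⟩ := Set.Infinite.exists_accPt_of_subset_isCompact hinf hZc subset_rfl
    obtain ⟨a, k, hk, hev⟩ := hloc x hx
    obtain ⟨z, hzZ, hz⟩ := ((accPt_iff_frequently_nhdsNE.1 hacc).and_eventually hev).exists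
    rw [show u z = 0 from hzZ.2, zero_div, zero_sub, norm_neg] at hz
    exact hk.not_ge hz
  lift Z to Finset ℂ using hfin with S hS
  have hSmem : ∀ x, x ∈ S ↔ x ∈ closedBall (0 : ℂ) 1 ∧ u x = 0 := fun x => by
    rw [← Finset.mem_coe, hZ]; rfl
  have hprod : ∀ z, z ∉ S → ∏ x ∈ S, (z - x) ≠ 0 := fun z hz =>
    Finset.prod_ne_zero_iff.2 fun x hx => sub_ne_zero.2 fun h => hz (h ▸ hx)
  have hdir : ∀ x ∈ S, ∃ c, ∀ᶠ z in 𝓝[≠] x, ‖u z / ∏ x ∈ S, (z - x) - c‖ < ‖c‖ := by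
    intro x hx
    obtain ⟨a, k, hk, hev⟩ := hloc x hx
    set w : ℂ → ℂ := fun z => (∏ y ∈ S.erase x, (z - y))⁻¹ with hw
    have hwx0 : ∏ y ∈ S.erase x, (x - y) ≠ 0 := Finset.prod_ne_zero_iff.2 fun y hy =>
      sub_ne_zero.2 (Finset.ne_of_mem_erase hy).symm
    have hwc : Tendsto w (𝓝 x) (𝓝 (w x)) :=
      ContinuousAt.inv₀ (Continuous.continuousAt (by fun_prop)) hwx0
    have hlim : Tendsto (fun z => k * ‖w z‖ + ‖a‖ * ‖w z - w x‖) (𝓝[≠] x) (𝓝 (k * ‖w x‖)) := by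
      have := (hwc.norm.const_mul k).add ((hwc.sub_const (w x)).norm.const_mul ‖a‖)
      rw [sub_self, norm_zero, mul_zero, add_zero] at this
      exact this.mono_left nhdsWithin_le_nhds
    have hlt : k * ‖w x‖ < ‖a * w x‖ := by
      rw [norm_mul]
      exact mul_lt_mul_of_pos_right hk (norm_pos_iff.2 (inv_ne_zero hwx0))
    refine ⟨a * w x, ?_⟩
    filter_upwards [hev, hlim.eventually_lt_const hlt] with z hz hz'
    have heq : u z / ∏ y ∈ S, (z - y) = u z / (z - x) * w z := by
      rw [← Finset.mul_prod_erase S _ hx, hw, div_mul_eq_div_mul_one_div, one_div]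
    calc ‖u z / ∏ y ∈ S, (z - y) - a * w x‖
        = ‖(u z / (z - x) - a) * w z + a * (w z - w x)‖ := by rw [heq]; ring_nf
      _ ≤ ‖u z / (z - x) - a‖ * ‖w z‖ + ‖a‖ * ‖w z - w x‖ := by
          rw [← norm_mul, ← norm_mul]; exact norm_add_le _ _
      _ ≤ k * ‖w z‖ + ‖a‖ * ‖w z - w x‖ := by gcongr
      _ < ‖a * w x‖ := hz'
  obtain ⟨R, hR, hR0, hRQ⟩ := exists_continuousOn_eqOn_sphere S
    (fun z => u z / ∏ x ∈ S, (z - x)) hZb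
    ((huc.mono sdiff_subset).div (by fun_prop) fun z hz => hprod z hz.2)
    (fun z hz => div_ne_zero (fun h => hz.2 ((hSmem z).2 ⟨hz.1, h⟩)) (hprod z hz.2))
    hdir
  have hlog : HasContinuousLogOn (fun z => R z * ∏ x ∈ S, (1 - x / z)) (sphere 0 1) := by
    refine ((HasContinuousLogOn.of_closedBall hR hR0).mono sphere_subset_closedBall).mul
      (HasContinuousLogOn.prod fun x hx => HasContinuousLogOn.of_mem_slitPlane ?_ ?_)
    · exact continuousOn_const.sub (continuousOn_const.div continuousOn_id
        fun z hz => ne_of_mem_sphere hz one_ne_zero)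
    · intro z hz
      rw [sub_eq_add_neg]
      refine Complex.mem_slitPlane_of_norm_lt_one ?_
      rw [norm_neg, norm_div, mem_sphere_zero_iff_norm.1 hz, div_one]
      exact mem_ball_zero_iff.1 (hZb x hx)
  have hcard : S.card ≤ 1 := by
    refine le_one_of_injOn_of_eq_pow_mul (u := u) (fun z hz w hw h => ?_) hlog fun z hz => ?_
    · exact hinj hz hw (sub_left_injective h)
    · have hz0 : z ≠ 0 := ne_of_mem_sphere hz one_ne_zero
      have hzS : z ∉ S := fun h => sphere_disjoint_ball.notMem_of_mem_left hz (hZb z h)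
      have : ∏ x ∈ S, (z - x) = z ^ S.card * ∏ x ∈ S, (1 - x / z) := by
        rw [← Finset.prod_const, ← Finset.prod_mul_distrib]
        exact Finset.prod_congr rfl fun x _ => by field_simp
      rw [hRQ hz, mul_left_comm, ← this, div_mul_cancel₀ _ (hprod z hzS)]
  refine Finset.card_le_one.1 hcard _ ((hSmem _).2 ?_) _ ((hSmem _).2 ?_)
  exacts [⟨ball_subset_closedBall hx₁, sub_eq_zero.2 h₁⟩,
    ⟨ball_subset_closedBall hx₂, sub_eq_zero.2 h₂⟩]

/-- The planar global inversion theorem, in complex coordinates. -/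
theorem Complex.injOn_closedBall_of_det_pos {f : ℂ → ℂ} {U : Set ℂ} (hU : IsOpen U)
    (hsub : closedBall 0 1 ⊆ U) (hf : ContDiffOn ℝ 1 f U)
    (hdet : ∀ x ∈ ball (0 : ℂ) 1, 0 < (fderiv ℝ f x).det) (hinj : InjOn f (sphere 0 1)) :
    InjOn f (closedBall 0 1) := by
  have hdiff : ∀ x ∈ closedBall (0 : ℂ) 1, ContDiffAt ℝ 1 f x := fun x hx =>
    hf.contDiffAt (hU.mem_nhds (hsub hx))
  have hfc : ContinuousOn f (closedBall 0 1) := hf.continuousOn.mono hsub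
  have hopen : ∀ x ∈ ball (0 : ℂ) 1, map f (𝓝 x) = 𝓝 (f x) := fun x hx => by
    refine ((hdiff x (ball_subset_closedBall hx)).hasStrictFDerivAt
      one_ne_zero).map_nhds_eq_of_surj ?_
    exact (LinearMap.isUnit_iff_range_eq_top _).1
      ((LinearMap.isUnit_iff_isUnit_det _).2 (hdet x hx).ne'.isUnit)
  have hdense : Dense (f '' sphere 0 1)ᶜ := by
    refine MeasureTheory.Measure.dense_of_ae (μ := MeasureTheory.volume) ?_
    refine MeasureTheory.measure_eq_zero_iff_ae_notMem.1 ?_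
    refine MeasureTheory.addHaar_image_eq_zero_of_differentiableOn_of_addHaar_eq_zero _
      ((hf.differentiableOn one_ne_zero).mono (sphere_subset_closedBall.trans hsub))
      (MeasureTheory.Measure.addHaar_sphere _ _ _)
  have hball : ∀ x₁ ∈ ball (0 : ℂ) 1, ∀ x₂ ∈ ball (0 : ℂ) 1, f x₁ = f x₂ → x₁ = x₂ := by
    intro x₁ hx₁ x₂ hx₂ h
    by_contra hne
    obtain ⟨V₁, V₂, hV₁, hV₂, hxV₁, hxV₂, hV⟩ := t2_separation hne
    have h₁ : f '' (V₁ ∩ ball 0 1) ∈ 𝓝 (f x₁) :=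
      hopen x₁ hx₁ ▸ image_mem_map ((hV₁.inter isOpen_ball).mem_nhds ⟨hxV₁, hx₁⟩)
    have h₂ : f '' (V₂ ∩ ball 0 1) ∈ 𝓝 (f x₁) :=
      h ▸ hopen x₂ hx₂ ▸ image_mem_map ((hV₂.inter isOpen_ball).mem_nhds ⟨hxV₂, hx₂⟩)
    obtain ⟨y, hy, ⟨z₁, hz₁, h₁⟩, ⟨z₂, hz₂, h₂⟩⟩ :=
      hdense.inter_nhds_nonempty (inter_mem h₁ h₂)
    refine hV.ne_of_mem hz₁.1 hz₂.1 (eq_of_notMem_image_sphere hfc (fun x hx =>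
      ⟨_, ((hdiff x (ball_subset_closedBall hx)).differentiableAt one_ne_zero).hasFDerivAt,
        hdet x hx⟩) hinj hy hz₁.2 hz₂.2 h₁ h₂)
  have hmixed : ∀ x₁ ∈ ball (0 : ℂ) 1, ∀ x₂ ∈ closedBall (0 : ℂ) 1, f x₁ = f x₂ → x₁ = x₂ := by
    intro x₁ hx₁ x₂ hx₂ h
    by_contra hne
    obtain ⟨V₁, V₂, hV₁, hV₂, hxV₁, hxV₂, hV⟩ := t2_separation hne
    have h₁ : f '' (V₁ ∩ ball 0 1) ∈ 𝓝 (f x₂) :=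
      h ▸ hopen x₁ hx₁ ▸ image_mem_map ((hV₁.inter isOpen_ball).mem_nhds ⟨hxV₁, hx₁⟩)
    have hcl : x₂ ∈ closure (ball (0 : ℂ) 1) := by rwa [closure_ball _ one_ne_zero]
    obtain ⟨z₂, ⟨hz₂V, z₁, hz₁, hz⟩, hz₂⟩ := mem_closure_iff_nhds.1 hcl _
      (inter_mem (hV₂.mem_nhds hxV₂) ((hdiff x₂ hx₂).continuousAt h₁))
    exact hV.ne_of_mem hz₁.1 hz₂V (hball _ hz₁.2 _ hz₂ hz)
  intro x₁ hx₁ x₂ hx₂ h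
  rw [← ball_union_sphere] at hx₁ hx₂
  rcases hx₁ with hx₁ | hx₁
  · exact hmixed _ hx₁ _ (ball_union_sphere.subset hx₂) h
  rcases hx₂ with hx₂ | hx₂
  · exact (hmixed _ hx₂ _ (sphere_subset_closedBall hx₁) h.symm).symm
  · exact hinj hx₁ hx₂ h

/-- Global invertibility (of Ciarlet type) on the closed unit disk in `ℝ²`: a `C¹` map
with positive Jacobian determinant in the open disk that is injective on the boundary
circle is injective on the closed disk, hence a bijection onto its image. -/
theorem injOn_closedBall_of_det_pos_of_injOn_sphere
    (f : EuclideanSpace ℝ (Fin 2) → EuclideanSpace ℝ (Fin 2))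
    (U : Set (EuclideanSpace ℝ (Fin 2))) (hU : IsOpen U)
    (hsub : Metric.closedBall (0 : EuclideanSpace ℝ (Fin 2)) 1 ⊆ U)
    (hf : ContDiffOn ℝ 1 f U)
    (hdet : ∀ x ∈ Metric.ball (0 : EuclideanSpace ℝ (Fin 2)) 1, 0 < (fderiv ℝ f x).det)
    (hinj : Set.InjOn f (Metric.sphere (0 : EuclideanSpace ℝ (Fin 2)) 1)) :
    Set.InjOn f (Metric.closedBall (0 : EuclideanSpace ℝ (Fin 2)) 1) ∧
      Set.BijOn f (Metric.closedBall (0 : EuclideanSpace ℝ (Fin 2)) 1)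
        (f '' Metric.closedBall (0 : EuclideanSpace ℝ (Fin 2)) 1) := by
  have main : Set.InjOn f (Metric.closedBall (0 : EuclideanSpace ℝ (Fin 2)) 1) := by
    let e : ℂ ≃ₗᵢ[ℝ] EuclideanSpace ℝ (Fin 2) := Complex.orthonormalBasisOneI.repr
    have hcb : ∀ z, z ∈ closedBall (0 : ℂ) 1 ↔ e z ∈ closedBall (0 : EuclideanSpace ℝ (Fin 2)) 1 :=
      fun z => by simp
    have hF : InjOn (fun z => e.symm (f (e z))) (closedBall 0 1) := by
      refine Complex.injOn_closedBall_of_det_pos (U := e ⁻¹' U) (hU.preimage e.continuous)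
        (fun z hz => hsub ((hcb z).1 hz)) ?_ (fun z hz => ?_) fun z hz w hw h => ?_
      · exact e.symm.contDiff.comp_contDiffOn
          (hf.comp e.contDiff.contDiffOn fun z hz => hz)
      · have hez : e z ∈ ball (0 : EuclideanSpace ℝ (Fin 2)) 1 := by simpa using hz
        have hfd : HasFDerivAt f (fderiv ℝ f (e z)) (e z) :=
          ((hf.contDiffAt (hU.mem_nhds (hsub (ball_subset_closedBall hez)))).differentiableAt
            one_ne_zero).hasFDerivAt
        have hcomp : HasFDerivAt (fun z => e.symm (f (e z)))
            ((e.symm.toContinuousLinearEquiv : _ →L[ℝ] ℂ).comp ((fderiv ℝ f (e z)).comp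
              (e.toContinuousLinearEquiv : ℂ →L[ℝ] _))) z :=
          e.symm.toContinuousLinearEquiv.hasFDerivAt.comp z
            (hfd.comp z e.toContinuousLinearEquiv.hasFDerivAt)
        rw [hcomp.fderiv]
        have := LinearMap.det_conj (fderiv ℝ f (e z)).toLinearMap e.symm.toLinearEquiv
        exact (hdet _ hez).trans_eq this.symm
      · exact e.injective (hinj (by simpa using hz) (by simpa using hw) (e.symm.injective h))
    intro x hx y hy hxy
    refine e.symm.injective (hF ((hcb _).2 (by simpa using hx)) ((hcb _).2 (by simpa using hy)) ?_)
    simp [hxy]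
  exact ⟨main, main.bijOn_image⟩
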